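/- arXiv:0906.3259 — 5 statements merged into one kernel-verified Lean document; each statement's English description precedes it below -/
import Mathlib

section
/- Let y : D → ℕ take values in {0,1} (so it is the indicator function of a single-replicate fraction F), with coefficients c_α. Then for every α ∈ L the coefficients satisfy the convolution identity c_α = Σ_{β ∈ L} c_β · c_{[α−β]}. -/
open scoped BigOperators Classical

/-- The interaction term `X^α` on the full factorial design, where a design
point `ζ` is coded by its exponents: the `j`-th coordinate of the point is
`exp(2πi ζ_j / n_j)`, and `X^α(ζ) = ∏_j exp(2πi α_j ζ_j / n_j)`. -/
noncomputable def Xterm (m : ℕ) (n : Fin m → ℕ) (α ζ : ∀ j, ZMod (n j)) : ℂ :=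
  ∏ j, Complex.exp (2 * (Real.pi : ℂ) * Complex.I * ((α j).val : ℂ) * ((ζ j).val : ℂ) / (n j : ℂ))

/-- The coefficient `c_α = (1/#D) Σ_{ζ∈D} y(ζ)·conj(X^α(ζ))` of the counting
function `y` of a fraction. -/
noncomputable def coeff (m : ℕ) (n : Fin m → ℕ) [∀ j, NeZero (n j)]
    (y : (∀ j, ZMod (n j)) → ℕ) (α : ∀ j, ZMod (n j)) : ℂ :=
  (∏ j, (n j : ℂ))⁻¹ * ∑ ζ : ∀ j, ZMod (n j), (y ζ : ℂ) * (starRingEnd ℂ) (Xterm m n α ζ)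

theorem Xterm_eq_prod_stdAddChar (m : ℕ) (n : Fin m → ℕ) [∀ j, NeZero (n j)]
    (α ζ : ∀ j, ZMod (n j)) :
    Xterm m n α ζ = ∏ j, ZMod.stdAddChar (α j * ζ j) := by
  refine Finset.prod_congr rfl fun j _ ↦ ?_
  have h := ZMod.stdAddChar_coe (N := n j) ((α j).val * (ζ j).val : ℤ)
  push_cast [ZMod.natCast_zmod_val] at h
  rw [h]
  ring_nf

theorem conj_Xterm (m : ℕ) (n : Fin m → ℕ) [∀ j, NeZero (n j)] (α ζ : ∀ j, ZMod (n j)) :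
    (starRingEnd ℂ) (Xterm m n α ζ) = ∏ j, ZMod.stdAddChar (-(α j * ζ j)) := by
  simp only [Xterm_eq_prod_stdAddChar, map_prod, AddChar.map_neg_eq_conj]

/-- Orthogonality of the interaction terms, in convolution form. -/
theorem sum_conj_Xterm_mul_conj_Xterm_sub (m : ℕ) (n : Fin m → ℕ) [∀ j, NeZero (n j)]
    (α ζ ξ : ∀ j, ZMod (n j)) :
    ∑ β : ∀ j, ZMod (n j),
        (starRingEnd ℂ) (Xterm m n β ζ) * (starRingEnd ℂ) (Xterm m n (α - β) ξ) =
      if ζ = ξ then (∏ j, (n j : ℂ)) * (starRingEnd ℂ) (Xterm m n α ξ) else 0 := by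
  have split (β : ∀ j, ZMod (n j)) :
      (starRingEnd ℂ) (Xterm m n β ζ) * (starRingEnd ℂ) (Xterm m n (α - β) ξ) =
        (∏ j, ZMod.stdAddChar (β j * (ξ j - ζ j))) * (starRingEnd ℂ) (Xterm m n α ξ) := by
    simp only [conj_Xterm, ← Finset.prod_mul_distrib, ← AddChar.map_add_eq_mul, Pi.sub_apply]
    refine Finset.prod_congr rfl fun j _ ↦ congrArg _ ?_
    ring
  simp only [split, ← Finset.sum_mul]
  rw [← Fintype.prod_sum (fun j (b : ZMod (n j)) ↦ ZMod.stdAddChar (b * (ξ j - ζ j)))]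
  simp only [AddChar.sum_mulShift _ (ZMod.isPrimitive_stdAddChar _), ZMod.card, sub_eq_zero]
  split_ifs with h
  · simp [h]
  · obtain ⟨j, hj⟩ := Function.ne_iff.mp h
    rw [Finset.prod_eq_zero (Finset.mem_univ j) (by simp [Ne.symm hj]), zero_mul]

/-- For a single-replicate fraction (the counting function `y` takes values in
`{0,1}`), the coefficients satisfy the convolution identity
`c_α = Σ_{β ∈ L} c_β · c_{[α−β]}`. -/
theorem coeff_convolution (m : ℕ) (hm : 1 ≤ m) (n : Fin m → ℕ) [∀ j, NeZero (n j)]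
    (y : (∀ j, ZMod (n j)) → ℕ) (hy : ∀ ζ, y ζ = 0 ∨ y ζ = 1) :
    ∀ α : ∀ j, ZMod (n j),
      coeff m n y α = ∑ β : ∀ j, ZMod (n j), coeff m n y β * coeff m n y (α - β) := by
  intro α
  have hN : (∏ j, (n j : ℂ)) ≠ 0 :=
    Finset.prod_ne_zero_iff.mpr fun j _ ↦ Nat.cast_ne_zero.mpr (NeZero.ne (n j))
  have hsq (ζ : ∀ j, ZMod (n j)) : (y ζ : ℂ) * y ζ = y ζ := by
    rcases hy ζ with h | h <;> simp [h]
  symm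
  calc ∑ β, coeff m n y β * coeff m n y (α - β)
      = (∏ j, (n j : ℂ))⁻¹ * (∏ j, (n j : ℂ))⁻¹ * ∑ ζ, ∑ ξ, (y ζ : ℂ) * y ξ *
          ∑ β, (starRingEnd ℂ) (Xterm m n β ζ) * (starRingEnd ℂ) (Xterm m n (α - β) ξ) := by
        simp only [coeff, mul_mul_mul_comm, Finset.sum_mul_sum, ← Finset.mul_sum]
        congr 1
        rw [Finset.sum_comm]
        refine Finset.sum_congr rfl fun ζ _ ↦ ?_
        rw [Finset.sum_comm]
        simp only [Finset.mul_sum]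
    _ = (∏ j, (n j : ℂ))⁻¹ * (∏ j, (n j : ℂ))⁻¹ *
          ∑ ζ, (∏ j, (n j : ℂ)) * ((y ζ : ℂ) * (starRingEnd ℂ) (Xterm m n α ζ)) := by
        congr 1
        refine Finset.sum_congr rfl fun ζ _ ↦ ?_
        simp only [sum_conj_Xterm_mul_conj_Xterm_sub, mul_ite, mul_zero, Finset.sum_ite_eq,
          Finset.mem_univ, if_true, hsq]
        ring
    _ = coeff m n y α := by
        rw [← Finset.mul_sum, coeff, mul_assoc, inv_mul_cancel_left₀ hN]
end

section
/- Let α ∈ L. For each j set s_j = 1 if α_j = 0 and s_j = n_j/gcd(α_j, n_j) otherwise, and let s = lcm(s_1, …, s_m). Then the interaction term X^α takes all the values of Ω_s equally often over D: for every ω ∈ Ω_s, #{ζ ∈ D : X^α(ζ) = ω} = #D/s. -/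
open scoped BigOperators Classical

/-- `Ω_n = {exp(2πi k/n) : k = 0,…,n−1}`, the set of `n`-th roots of unity,
as a finite set of complex numbers. -/
noncomputable def OmegaF (n : ℕ) : Finset ℂ :=
  (Finset.range n).image (fun k => Complex.exp (2 * (Real.pi : ℂ) * Complex.I * (k : ℂ) / (n : ℂ)))

/-- The order of an element of `ZMod n`, as the reduced denominator of the corresponding fraction. -/
theorem addOrderOf_zmod_eq_ite (n : ℕ) [NeZero n] (a : ZMod n) :
    addOrderOf a = if a = 0 then 1 else n / Nat.gcd a.val n := by
  split_ifs with h
  · simp [h]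
  · conv_lhs => rw [← ZMod.natCast_zmod_val a]
    rw [ZMod.addOrderOf_coe _ (NeZero.ne n), Nat.gcd_comm]

/-- A character of a finite group whose values have exponent `s` takes each `s`-th root of unity
equally often. -/
theorem MonoidHom.card_fiber_mul_eq_card {G : Type*} [Group G] [Fintype G] (F : G →* ℂˣ) (s : ℕ)
    (hF : ∀ k : ℕ, (∀ g, F g ^ k = 1) ↔ s ∣ k) (w : ℂˣ) (hw : w ^ s = 1) :
    (Finset.univ.filter (fun g => F g = w)).card * s = Fintype.card G := by
  have hexp : Monoid.exponent F.range = s := by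
    refine Nat.dvd_antisymm (Monoid.exponent_dvd_of_forall_pow_eq_one ?_) ((hF _).1 fun g => ?_)
    · rintro ⟨_, g, rfl⟩
      exact Subtype.ext ((hF s).2 dvd_rfl g)
    · exact congrArg Subtype.val
        (Monoid.pow_exponent_eq_one (⟨F g, g, rfl⟩ : F.range))
  have hfin : Finite F.range := Finite.of_surjective _ F.rangeRestrict_surjective
  have hcard : Nat.card F.range = s := by
    rw [← hexp, IsCyclic.exponent_eq_card]
  have hs : NeZero s := ⟨hcard ▸ Nat.card_pos.ne'⟩
  have hle : F.range ≤ rootsOfUnity s ℂ := by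
    rintro _ ⟨g, rfl⟩
    exact (hF s).2 dvd_rfl g
  have hrange : F.range = rootsOfUnity s ℂ :=
    Subgroup.eq_of_le_of_card_ge hle <| by
      rw [hcard, Complex.card_rootsOfUnity]
  have hmem : w ∈ F.range := hrange ▸ (mem_rootsOfUnity s w).2 hw
  have himage : (Finset.univ.image F).card = s := by
    rw [← hcard, ← Set.ncard_coe_finset, Finset.coe_image, Finset.coe_univ, Set.image_univ]
    rfl
  rw [← Finset.card_univ, Finset.card_eq_sum_card_image F Finset.univ, mul_comm,
    Finset.sum_const_nat (m := (Finset.univ.filter (fun g => F g = w)).card), himage]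
  intro x hx
  obtain ⟨g, -, rfl⟩ := Finset.mem_image.1 hx
  exact MonoidHom.card_fiber_eq_of_mem_range F ⟨g, rfl⟩ hmem

/-- The interaction term as a group homomorphism on the full design. -/
noncomputable def XtermHom (m : ℕ) (n : Fin m → ℕ) [∀ j, NeZero (n j)] (α : ∀ j, ZMod (n j)) :
    Multiplicative (∀ j, ZMod (n j)) →* ℂˣ :=
  MonoidHom.toHomUnits
    { toFun := fun ζ => Xterm m n α ζ.toAdd
      map_one' := by simp [Xterm]
      map_mul' := fun x y => by
        simp [Xterm_eq_prod_stdAddChar, mul_add, AddChar.map_add_eq_mul, Finset.prod_mul_distrib] }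

theorem coe_XtermHom (m : ℕ) (n : Fin m → ℕ) [∀ j, NeZero (n j)] (α : ∀ j, ZMod (n j))
    (ζ : Multiplicative (∀ j, ZMod (n j))) :
    (XtermHom m n α ζ : ℂ) = Xterm m n α ζ.toAdd := rfl

theorem Xterm_pow (m : ℕ) (n : Fin m → ℕ) [∀ j, NeZero (n j)] (α ζ : ∀ j, ZMod (n j)) (k : ℕ) :
    Xterm m n α ζ ^ k = Xterm m n (k • α) ζ := by
  simp only [Xterm_eq_prod_stdAddChar, ← Finset.prod_pow, ← AddChar.map_nsmul_eq_pow,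
    Pi.smul_apply, smul_mul_assoc]

theorem forall_Xterm_eq_one_iff (m : ℕ) (n : Fin m → ℕ) [∀ j, NeZero (n j)]
    (α : ∀ j, ZMod (n j)) : (∀ ζ, Xterm m n α ζ = 1) ↔ α = 0 := by
  refine ⟨fun h => funext fun j => ?_, fun h ζ => by simp [h, Xterm]⟩
  have hj := h (Pi.single j 1)
  rw [Xterm_eq_prod_stdAddChar, Finset.prod_eq_single j
    (fun i _ hi => by simp [Pi.single_eq_of_ne hi]) (by simp), Pi.single_eq_same, mul_one,
    ← AddChar.map_zero_eq_one (ZMod.stdAddChar (N := n j))] at hj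
  exact ZMod.injective_stdAddChar hj

/-- The exponent of the values of `X^α` is the least common multiple of the orders of the
coordinates of `α`. -/
theorem XtermHom_pow_eq_one_iff (m : ℕ) (n : Fin m → ℕ) [∀ j, NeZero (n j)]
    (α : ∀ j, ZMod (n j)) (k : ℕ) :
    (∀ ζ, XtermHom m n α ζ ^ k = 1) ↔ Finset.univ.lcm (fun j => addOrderOf (α j)) ∣ k := by
  simp only [Finset.lcm_dvd_iff, Finset.mem_univ, true_imp_iff, addOrderOf_dvd_iff_nsmul_eq_zero,
    Units.ext_iff, Units.val_pow_eq_pow_val, coe_XtermHom, Units.val_one, Xterm_pow]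
  exact (forall_Xterm_eq_one_iff m n (k • α)).trans funext_iff

/-- Elements of `Ω_s` are `s`-th roots of unity. -/
theorem pow_eq_one_of_mem_OmegaF {s : ℕ} {ω : ℂ} (h : ω ∈ OmegaF s) : ω ^ s = 1 := by
  obtain ⟨_, hk, rfl⟩ := Finset.mem_image.1 h
  simp only [Finset.bind_def, Finset.pure_def, Finset.mem_sup, Finset.mem_singleton] at hk
  obtain ⟨k, hk, rfl⟩ := hk
  have hs : (s : ℂ) ≠ 0 := Nat.cast_ne_zero.2 (Nat.ne_zero_of_lt (Finset.mem_range.1 hk))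
  rw [← Complex.exp_nat_mul, Complex.exp_eq_one_iff]
  exact ⟨k, by push_cast; field_simp⟩

/-- Over the full design `D`, the interaction term `X^α` takes all the values
of `Ω_s` equally often, where `s = lcm(s_1,…,s_m)` with `s_j = 1` if `α_j = 0`
and `s_j = n_j / gcd(α_j, n_j)` otherwise: every fiber has `#D/s` points. -/
theorem Xterm_uniform_on_roots (m : ℕ) (hm : 1 ≤ m) (n : Fin m → ℕ) [∀ j, NeZero (n j)]
    (α : ∀ j, ZMod (n j)) (s : ℕ)
    (hs : s = Finset.univ.lcm (fun j => if α j = 0 then 1 else n j / Nat.gcd (α j).val (n j))) :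
    ∀ ω ∈ OmegaF s,
      (Finset.univ.filter (fun ζ : ∀ j, ZMod (n j) => Xterm m n α ζ = ω)).card =
        (∏ j, n j) / s := by
  intro ω hω
  have hs0 : s ≠ 0 := by
    rintro rfl
    simp [OmegaF] at hω
  simp only [← addOrderOf_zmod_eq_ite] at hs
  have hpow := pow_eq_one_of_mem_OmegaF hω
  obtain ⟨w, rfl⟩ : IsUnit ω := IsUnit.of_pow_eq_one hpow hs0
  have key := MonoidHom.card_fiber_mul_eq_card (XtermHom m n α) s
    (fun k => hs ▸ XtermHom_pow_eq_one_iff m n α k) w (Units.ext (by simpa using hpow))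
  have hG : Fintype.card (Multiplicative (∀ j, ZMod (n j))) = ∏ j, n j := by
    simp [Fintype.card_pi, ZMod.card]
  rw [hG] at key
  refine (Nat.div_eq_of_eq_mul_left (Nat.pos_of_ne_zero hs0) (key.symm.trans ?_)).symm
  congr 1
  refine Finset.card_equiv Multiplicative.toAdd fun ζ => ?_
  simp [Units.ext_iff, coe_XtermHom]
end

section
/- Let y : D → ℕ be a counting function with coefficients c_α and let α ∈ L whose associated level number s is a prime. Then c_α = 0 if and only if the s levels of X^α appear equally often in the fraction, i.e. n_{α,0} = n_{α,1} = ⋯ = n_{α,s−1}. -/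
open scoped BigOperators Classical

/-- The level number `s` associated to the term `X^α`:
`s = lcm(s_1,…,s_m)` with `s_j = 1` if `α_j = 0` and `s_j = n_j / gcd(α_j, n_j)`
otherwise, so that `X^α` takes values in the `s`-th roots of unity `Ω_s`. -/
noncomputable def levelS (m : ℕ) (n : Fin m → ℕ) (α : ∀ j, ZMod (n j)) : ℕ :=
  Finset.univ.lcm (fun j => if α j = 0 then 1 else n j / Nat.gcd (α j).val (n j))

/-- The strata count `n_{α,h} = Σ_{ζ ∈ D_h^α} y(ζ)`, where
`D_h^α = {ζ ∈ D : conj(X^α(ζ)) = exp(2πi h/s)}` and `s = levelS m n α`. -/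
noncomputable def strataCount (m : ℕ) (n : Fin m → ℕ) [∀ j, NeZero (n j)]
    (y : (∀ j, ZMod (n j)) → ℕ) (α : ∀ j, ZMod (n j)) (h : ℕ) : ℕ :=
  ∑ ζ ∈ Finset.univ.filter (fun ζ => (starRingEnd ℂ) (Xterm m n α ζ) =
      Complex.exp (2 * (Real.pi : ℂ) * Complex.I * (h : ℂ) / (levelS m n α : ℂ))), y ζ

lemma Xterm_pow_levelS (m : ℕ) (n : Fin m → ℕ) [∀ j, NeZero (n j)]
    (α ζ : ∀ j, ZMod (n j)) : Xterm m n α ζ ^ levelS m n α = 1 := by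
  rw [Xterm, ← Finset.prod_pow]
  refine Finset.prod_eq_one fun j _ => ?_
  have hn : (n j : ℂ) ≠ 0 := Nat.cast_ne_zero.mpr (NeZero.ne (n j))
  have hdvd : n j ∣ levelS m n α * (α j).val := by
    by_cases h : α j = 0
    · simp [h]
    · have hj : n j / Nat.gcd (α j).val (n j) ∣ levelS m n α := by
        simpa only [h, if_false] using! Finset.dvd_lcm (f := fun j => if α j = 0 then 1
          else n j / Nat.gcd (α j).val (n j)) (Finset.mem_univ j)
      calc n j = n j / Nat.gcd (α j).val (n j) * Nat.gcd (α j).val (n j) :=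
            (Nat.div_mul_cancel (Nat.gcd_dvd_right _ _)).symm
        _ ∣ _ := mul_dvd_mul hj (Nat.gcd_dvd_left _ _)
  obtain ⟨k, hk⟩ := hdvd
  have hk' : (levelS m n α : ℂ) * ((α j).val : ℂ) = n j * k := mod_cast hk
  rw [← Complex.exp_nat_mul, Complex.exp_eq_one_iff]
  refine ⟨k * (ζ j).val, ?_⟩
  push_cast
  field_simp
  linear_combination ((ζ j).val : ℂ) * hk'

lemma exp_level_eq_pow (s h : ℕ) :
    Complex.exp (2 * (Real.pi : ℂ) * Complex.I * (h : ℂ) / (s : ℂ)) =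
      Complex.exp (2 * (Real.pi : ℂ) * Complex.I / (s : ℂ)) ^ h := by
  rw [← Complex.exp_nat_mul]
  ring_nf

lemma sum_conj_Xterm_eq_sum_strataCount (m : ℕ) (n : Fin m → ℕ) [∀ j, NeZero (n j)]
    (y : (∀ j, ZMod (n j)) → ℕ) (α : ∀ j, ZMod (n j)) (hs : levelS m n α ≠ 0) :
    ∑ ζ : ∀ j, ZMod (n j), (y ζ : ℂ) * (starRingEnd ℂ) (Xterm m n α ζ) =
      ∑ h ∈ Finset.range (levelS m n α), (strataCount m n y α h : ℂ) *
        Complex.exp (2 * (Real.pi : ℂ) * Complex.I / (levelS m n α : ℂ)) ^ h := by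
  have : NeZero (levelS m n α) := ⟨hs⟩
  have hω := Complex.isPrimitiveRoot_exp _ hs
  simp only [strataCount, exp_level_eq_pow, Nat.cast_sum, Finset.sum_mul, Finset.sum_filter]
  rw [Finset.sum_comm]
  refine Finset.sum_congr rfl fun ζ _ => ?_
  obtain ⟨i, hi, hiω⟩ := hω.eq_pow_of_pow_eq_one
    (show (starRingEnd ℂ) (Xterm m n α ζ) ^ levelS m n α = 1 by
      rw [← map_pow, Xterm_pow_levelS, map_one])
  rw [Finset.sum_eq_single_of_mem i (Finset.mem_range.mpr hi), if_pos hiω.symm, hiω]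
  intro h hh hne
  rw [if_neg fun heq => hne (hω.pow_inj (Finset.mem_range.mp hh) hi (heq.symm.trans hiω.symm)),
    Nat.cast_zero, zero_mul]

/-- When the level number `s` of `X^α` is prime, `c_α = 0` iff the `s` levels
of `X^α` appear equally often in the fraction:
`n_{α,0} = n_{α,1} = ⋯ = n_{α,s−1}`. -/
theorem coeff_zero_iff_strata_equal (m : ℕ) (hm : 1 ≤ m) (n : Fin m → ℕ) [∀ j, NeZero (n j)]
    (y : (∀ j, ZMod (n j)) → ℕ) (α : ∀ j, ZMod (n j)) (hs : (levelS m n α).Prime) :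
    coeff m n y α = 0 ↔
      ∀ h h' : ℕ, h < levelS m n α → h' < levelS m n α →
        strataCount m n y α h = strataCount m n y α h' := by
  have hD : (∏ j, (n j : ℂ))⁻¹ ≠ 0 :=
    inv_ne_zero (Finset.prod_ne_zero_iff.mpr fun j _ => Nat.cast_ne_zero.mpr (NeZero.ne (n j)))
  rw [coeff, mul_eq_zero, or_iff_right hD, sum_conj_Xterm_eq_sum_strataCount m n y α hs.ne_zero]
  rw [Finset.sum_range]
  have key := (Complex.isPrimitiveRoot_exp _ hs.ne_zero).sum_eq_zero_iff_forall_eq_int hs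
    fun h => (strataCount m n y α h : ℤ)
  push_cast at key
  rw [key]
  exact ⟨fun H h h' hh hh' => Nat.cast_injective (H ⟨h, hh⟩ ⟨h', hh'⟩),
    fun H i j => congrArg _ (H i j i.2 j.2)⟩
end

section
/- Suppose all m factors have the same prime number s of levels (n_1 = ⋯ = n_m = s), and let y : D → ℕ be a counting function with coefficients c_α. If c_α = 0 for some α ∈ L = (ℤ_s)^m, then c_{[k·α]} = 0 for every k = 1, …, s−1, where [k·α] denotes the k-fold sum α + ⋯ + α in the group (ℤ_s)^m. -/
open scoped BigOperators Classical

/-- An integer polynomial vanishing at a primitive `s`-th root of unity also vanishes at its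
powers with exponent coprime to `s`. -/
theorem IsPrimitiveRoot.aeval_pow_eq_zero_of_coprime {s k : ℕ} (hs : 0 < s) {w : ℂ}
    (hw : IsPrimitiveRoot w s) (hk : k.Coprime s) {P : Polynomial ℤ}
    (hP : Polynomial.aeval w P = 0) : Polynomial.aeval (w ^ k) P = 0 := by
  obtain ⟨Q, rfl⟩ := minpoly.isIntegrallyClosed_dvd (hw.isIntegral hs) hP
  rw [hw.minpoly_eq_pow_coprime hk]
  simp

theorem Xterm_const_eq_pow (m s : ℕ) (α ζ : Fin m → ZMod s) :
    Xterm m (fun _ => s) α ζ =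
      Complex.exp (2 * Real.pi * Complex.I / s) ^ ∑ j, (α j).val * (ζ j).val := by
  rw [Xterm, ← Finset.prod_pow_eq_pow_sum]
  refine Finset.prod_congr rfl fun j _ => ?_
  rw [← Complex.exp_nat_mul]
  congr 1
  push_cast
  ring

theorem Xterm_const_nsmul (m s : ℕ) (hs : s ≠ 0) (k : ℕ) (α ζ : Fin m → ZMod s) :
    Xterm m (fun _ => s) (k • α) ζ = Xterm m (fun _ => s) α ζ ^ k := by
  have : NeZero s := ⟨hs⟩
  rw [Xterm_const_eq_pow, Xterm_const_eq_pow, ← pow_mul]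
  refine pow_eq_pow_of_modEq ?_ (Complex.isPrimitiveRoot_exp s hs).pow_eq_one
  rw [← ZMod.natCast_eq_natCast_iff]
  simp [Finset.sum_mul, mul_right_comm, mul_comm (k : ZMod s)]

/-- When all `m` factors have the same prime number `s` of levels, if `c_α = 0`
then `c_{[k·α]} = 0` for every `k = 1,…,s−1`, where `[k·α]` is the `k`-fold sum
`α + ⋯ + α` in the group `(ℤ_s)^m`. -/
theorem coeff_smul_zero_of_coeff_zero (m : ℕ) (hm : 1 ≤ m) (s : ℕ) (hs : s.Prime)
    (n : Fin m → ℕ) [∀ j, NeZero (n j)] (hn : ∀ j, n j = s)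
    (y : (∀ j, ZMod (n j)) → ℕ) (α : ∀ j, ZMod (n j)) (hc : coeff m n y α = 0) :
    ∀ k : ℕ, 1 ≤ k → k ≤ s - 1 → coeff m n y (k • α) = 0 := by
  intro k hk hks
  obtain rfl : n = fun _ => s := funext hn
  have hcop : k.Coprime s :=
    (Nat.coprime_of_lt_prime (by omega) (by have := hs.pos; omega) hs).symm
  have hw := (Complex.isPrimitiveRoot_exp s hs.ne_zero).map_of_injective
    (f := starRingEnd ℂ) (starRingEnd ℂ).injective
  have hs0 : (s : ℂ) ≠ 0 := Nat.cast_ne_zero.mpr hs.ne_zero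
  rw [coeff, mul_eq_zero, or_iff_right (inv_ne_zero (Finset.prod_ne_zero_iff.mpr
    fun _ _ => hs0))] at hc
  have hP := hw.aeval_pow_eq_zero_of_coprime hs.pos hcop
    (P := ∑ ζ : Fin m → ZMod s, (y ζ : Polynomial ℤ) *
      Polynomial.X ^ ∑ j, (α j).val * (ζ j).val)
    (by simpa [Xterm_const_eq_pow] using hc)
  rw [coeff, mul_eq_zero]
  right
  simp only [Xterm_const_nsmul m s hs.ne_zero, Xterm_const_eq_pow, map_pow]
  simpa [← pow_mul, mul_comm k] using hP
end

section
/- Let y : D → ℕ be a counting function with coefficients c_α, let I ⊆ {1,…,m} with complement J, and let L_I = {α ∈ L : α_j = 0 for all j ∈ J}. Then for every ζ = (ζ_I, ζ_J) ∈ D the margin satisfies R_I(ζ_I) = Σ_{η ∈ D_J} y(ζ_I, η) = #D_J · Σ_{α ∈ L_I} c_α · X^α(ζ), where D_J = Π_{j∈J} Ω_{n_j} (and the right-hand side depends only on ζ_I, since X^α with α ∈ L_I depends only on the I-components). -/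
open scoped BigOperators Classical

/-- Each factor of an interaction term is a value of the standard additive character. -/
lemma exp_val_mul_val_eq_stdAddChar {N : ℕ} [NeZero N] (a b : ZMod N) :
    Complex.exp (2 * (Real.pi : ℂ) * Complex.I * (a.val : ℂ) * (b.val : ℂ) / (N : ℂ)) =
      ZMod.stdAddChar (a * b) := by
  have h := ZMod.stdAddChar_coe (N := N) ((a.val * b.val : ℕ) : ℤ)
  push_cast at h
  rw [ZMod.natCast_zmod_val, ZMod.natCast_zmod_val] at h
  rw [h]
  congr 1
  ring

/-- Orthogonality of the characters of `ZMod N`. -/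
lemma sum_conj_stdAddChar_mul {N : ℕ} [NeZero N] (a b : ZMod N) :
    ∑ k : ZMod N, (starRingEnd ℂ) (ZMod.stdAddChar (k * a)) * ZMod.stdAddChar (k * b) =
      if a = b then (N : ℂ) else 0 := by
  have h := AddChar.sum_mulShift (b - a) (ZMod.isPrimitive_stdAddChar N)
  rw [ZMod.card] at h
  have hab : (b - a = 0) ↔ a = b := by rw [sub_eq_zero, eq_comm]
  simp only [hab, Nat.cast_ite, Nat.cast_zero] at h
  rw [← h]
  refine Finset.sum_congr rfl fun k _ => ?_
  rw [← AddChar.map_neg_eq_conj, ← AddChar.map_add_eq_mul]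
  congr 1
  ring

/-- Orthogonality of the interaction terms supported on `I`. -/
lemma sum_conj_Xterm_mul_Xterm (m : ℕ) (n : Fin m → ℕ) [∀ j, NeZero (n j)]
    (I : Finset (Fin m)) (η ζ : ∀ j, ZMod (n j)) :
    ∑ α ∈ Finset.univ.filter (fun α : ∀ j, ZMod (n j) => ∀ j ∉ I, α j = 0),
        (starRingEnd ℂ) (Xterm m n α η) * Xterm m n α ζ =
      if ∀ j ∈ I, η j = ζ j then ∏ j ∈ I, (n j : ℂ) else 0 := by
  have hset : Finset.univ.filter (fun α : ∀ j, ZMod (n j) => ∀ j ∉ I, α j = 0) =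
      Fintype.piFinset fun j => if j ∈ I then Finset.univ else {0} := by
    ext α
    simp only [Finset.mem_filter, Finset.mem_univ, true_and, Fintype.mem_piFinset]
    refine forall_congr' fun j => ?_
    by_cases hj : j ∈ I <;> simp [hj]
  simp only [hset, Xterm, exp_val_mul_val_eq_stdAddChar, map_prod, ← Finset.prod_mul_distrib]
  rw [← Finset.prod_univ_sum (fun j => if j ∈ I then Finset.univ else {0})
    (fun j a => (starRingEnd ℂ) (ZMod.stdAddChar (a * η j)) * ZMod.stdAddChar (a * ζ j))]
  have hfactor : ∀ j, ∑ a ∈ (if j ∈ I then Finset.univ else {0} : Finset (ZMod (n j))),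
      (starRingEnd ℂ) (ZMod.stdAddChar (a * η j)) * ZMod.stdAddChar (a * ζ j) =
        if j ∈ I then (if η j = ζ j then (n j : ℂ) else 0) else 1 := by
    intro j
    by_cases hj : j ∈ I
    · simp only [hj, if_true, sum_conj_stdAddChar_mul]
    · simp [hj]
  simp only [hfactor, Finset.prod_ite_mem, Finset.univ_inter]
  rw [Finset.prod_ite_zero (p := fun j => η j = ζ j)]
  congr

/-- Margin formula: for `I ⊆ {1,…,m}` with complement `J` and
`L_I = {α ∈ L : α_j = 0 for j ∈ J}`, the margin satisfies
`R_I(ζ_I) = Σ_{η ∈ D_J} y(ζ_I, η) = #D_J · Σ_{α ∈ L_I} c_α · X^α(ζ)`. -/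
theorem margin_eq_sum_coeffs (m : ℕ) (hm : 1 ≤ m) (n : Fin m → ℕ) [∀ j, NeZero (n j)]
    (y : (∀ j, ZMod (n j)) → ℕ) (I : Finset (Fin m)) :
    ∀ ζ : ∀ j, ZMod (n j),
      ((∑ η ∈ Finset.univ.filter (fun η : ∀ j, ZMod (n j) => ∀ j ∈ I, η j = ζ j), y η : ℕ) : ℂ) =
        (∏ j ∈ Iᶜ, (n j : ℂ)) *
          ∑ α ∈ Finset.univ.filter (fun α : ∀ j, ZMod (n j) => ∀ j ∉ I, α j = 0),
            coeff m n y α * Xterm m n α ζ := by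
  intro ζ
  have hsum : ∑ α ∈ Finset.univ.filter (fun α : ∀ j, ZMod (n j) => ∀ j ∉ I, α j = 0),
      coeff m n y α * Xterm m n α ζ = (∏ j, (n j : ℂ))⁻¹ * ∑ η : ∀ j, ZMod (n j),
        (y η : ℂ) * if ∀ j ∈ I, η j = ζ j then ∏ j ∈ I, (n j : ℂ) else 0 := by
    simp only [← sum_conj_Xterm_mul_Xterm, coeff, Finset.mul_sum, Finset.sum_mul]
    rw [Finset.sum_comm]
    simp only [mul_assoc]
  have hprod : (∏ j ∈ I, (n j : ℂ)) * ∏ j ∈ Iᶜ, (n j : ℂ) = ∏ j, (n j : ℂ) :=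
    Finset.prod_mul_prod_compl I _
  have hne : ∏ j, (n j : ℂ) ≠ 0 :=
    Finset.prod_ne_zero_iff.mpr fun j _ => Nat.cast_ne_zero.mpr (NeZero.ne (n j))
  simp only [hsum, mul_ite, mul_zero, ← Finset.sum_filter, ← Finset.sum_mul]
  rw [Nat.cast_sum]
  field_simp
  rw [← hprod]
  ring
end
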